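/- Let k ≥ 1 and let S ⊂ ℤ^k be a finite set, let m ≥ 2 be an integer and let v ∈ ℂ^k be a nonzero vector. Then the following are equivalent: (1) Q_{c,m}(v) = 0 for every c ∈ K_{m−1}(S); (2) there exists a polynomial F ∈ ℂ[x₁,…,x_k] of total degree ≤ m which vanishes at every point of S and whose degree-m homogeneous component equals (v₁x₁+⋯+v_kx_k)^m. (Condition (1) is the coordinate description of the statement that [v] ∈ ℙ^{k−1} is a base point of the m-th fundamental form at the point 1 of the projective toric variety parametrized by the Laurent monomials with exponents in S.) -/

import Mathlib

open MvPolynomial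

/-- The value of the falling-factorial polynomial `P_α` at the integer point `p`:
`P_α(x) = ∏_i x_i (x_i - 1) ⋯ (x_i - α_i + 1)`. -/
noncomputable def fallingEval {k : ℕ} (α : Fin k → ℕ) (p : Fin k → ℤ) : ℂ :=
  ∏ i, ∏ j ∈ Finset.range (α i), ((p i : ℂ) - (j : ℂ))

/-- `c` belongs to `K_d(S)`: `∑_{p ∈ S} c_p q(p) = 0` for every polynomial `q` of
total degree at most `d`. -/
def inKernel {k : ℕ} (S : Finset (Fin k → ℤ)) (d : ℕ) (c : (Fin k → ℤ) → ℂ) : Prop :=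
  ∀ q : MvPolynomial (Fin k) ℂ, q.totalDegree ≤ d →
    ∑ p ∈ S, c p * MvPolynomial.eval (fun i => (p i : ℂ)) q = 0

/-- The homogeneous degree-`m` polynomial `Q_{c,m}` evaluated at `w`:
`Q_{c,m}(w) = ∑_{p ∈ S} c_p ∑_{|α| = m} (m!/α!) w^α P_α(p)`. -/
noncomputable def Qform {k : ℕ} (S : Finset (Fin k → ℤ)) (m : ℕ) (c : (Fin k → ℤ) → ℂ)
    (w : Fin k → ℂ) : ℂ :=
  ∑ p ∈ S, c p *
    ∑ α ∈ (Fintype.piFinset fun _ : Fin k => Finset.range (m + 1)).filter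
        (fun α => ∑ i, α i = m),
      ((Nat.factorial m : ℂ) / ∏ i, (Nat.factorial (α i) : ℂ)) * (∏ i, w i ^ α i) *
        fallingEval α p

namespace MvPolynomial

theorem homogeneousComponent_add_mul {σ R : Type*} [CommSemiring R] {f g : MvPolynomial σ R}
    {a b : ℕ} (hf : f.totalDegree ≤ a) (hg : g.totalDegree ≤ b) :
    homogeneousComponent (a + b) (f * g) =
      homogeneousComponent a f * homogeneousComponent b g := by
  classical
  ext d
  by_cases hd : d.degree = a + b
  · rw [coeff_homogeneousComponent, if_pos hd, coeff_mul, coeff_mul]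
    refine Finset.sum_congr rfl fun x hx => ?_
    have hx' : x.1.degree + x.2.degree = a + b := by
      rw [← map_add, Finset.HasAntidiagonal.mem_antidiagonal.mp hx, hd]
    rw [coeff_homogeneousComponent, coeff_homogeneousComponent]
    rcases lt_trichotomy x.1.degree a with h | h | h
    · have h0 : coeff x.2 g = 0 :=
        coeff_eq_zero_of_totalDegree_lt (show g.totalDegree < x.2.degree by omega)
      simp [h0]
    · rw [if_pos h, if_pos (by omega)]
    · have h0 : coeff x.1 f = 0 :=
        coeff_eq_zero_of_totalDegree_lt (show f.totalDegree < x.1.degree by omega)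
      simp [h0]
  · rw [coeff_homogeneousComponent, if_neg hd]
    exact (((homogeneousComponent_isHomogeneous a f).mul
      (homogeneousComponent_isHomogeneous b g)).coeff_eq_zero hd).symm

theorem homogeneousComponent_finsetSum_prod {σ R ι : Type*} [CommSemiring R] (s : Finset ι)
    (f : ι → MvPolynomial σ R) (a : ι → ℕ) (hf : ∀ i ∈ s, (f i).totalDegree ≤ a i) :
    homogeneousComponent (∑ i ∈ s, a i) (∏ i ∈ s, f i) =
      ∏ i ∈ s, homogeneousComponent (a i) (f i) := by
  classical
  induction s using Finset.induction_on with
  | empty => simp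
  | insert i s hi ih =>
    have hs : ∀ j ∈ s, (f j).totalDegree ≤ a j := fun j hj => hf j (Finset.mem_insert_of_mem hj)
    rw [Finset.sum_insert hi, Finset.prod_insert hi, Finset.prod_insert hi, ← ih hs]
    exact homogeneousComponent_add_mul (hf i (Finset.mem_insert_self i s))
      ((totalDegree_finsetProd s f).trans (Finset.sum_le_sum hs))

theorem totalDegree_le_pred_of_homogeneousComponent_eq_zero {σ R : Type*} [CommSemiring R]
    {f : MvPolynomial σ R} {m : ℕ} (hf : f.totalDegree ≤ m)
    (h : homogeneousComponent m f = 0) : f.totalDegree ≤ m - 1 := by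
  refine Finset.sup_le fun d hd => ?_
  have hle : d.degree ≤ m := (le_totalDegree hd).trans hf
  have hne : d.degree ≠ m := fun hdm => by
    have hc := coeff_homogeneousComponent m f d
    rw [h, if_pos hdm, coeff_zero] at hc
    exact mem_support_iff.mp hd hc.symm
  change d.degree ≤ m - 1
  omega

theorem totalDegree_X_sub_C_le {σ R : Type*} [CommRing R] [Nontrivial R] (i : σ) (r : R) :
    (X i - C r : MvPolynomial σ R).totalDegree ≤ 1 :=
  (totalDegree_sub_C_le _ _).trans (totalDegree_X i).le

theorem homogeneousComponent_one_X_sub_C {σ R : Type*} [CommRing R] (i : σ) (r : R) :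
    homogeneousComponent 1 (X i - C r : MvPolynomial σ R) = X i := by
  rw [map_sub, homogeneousComponent_eq_self (isHomogeneous_X R i),
    homogeneousComponent_eq_zero _ _ (by simp), sub_zero]

end MvPolynomial

/-- The falling-factorial polynomial `P_α`. -/
noncomputable def fallingPoly {k : ℕ} (α : Fin k → ℕ) : MvPolynomial (Fin k) ℂ :=
  ∏ i, ∏ j ∈ Finset.range (α i), (X i - C (j : ℂ))

theorem eval_fallingPoly {k : ℕ} (α : Fin k → ℕ) (p : Fin k → ℤ) :
    eval (fun i => (p i : ℂ)) (fallingPoly α) = fallingEval α p := by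
  simp [fallingPoly, fallingEval]

theorem totalDegree_prod_X_sub_C_le {k : ℕ} (i : Fin k) (n : ℕ) :
    (∏ j ∈ Finset.range n, (X i - C (j : ℂ)) : MvPolynomial (Fin k) ℂ).totalDegree ≤ n := by
  refine (totalDegree_finsetProd _ _).trans ?_
  simpa using Finset.sum_le_card_nsmul (Finset.range n) _ 1
    fun j _ => totalDegree_X_sub_C_le i (j : ℂ)

theorem homogeneousComponent_prod_X_sub_C {k : ℕ} (i : Fin k) (n : ℕ) :
    homogeneousComponent n
      (∏ j ∈ Finset.range n, (X i - C (j : ℂ)) : MvPolynomial (Fin k) ℂ) = X i ^ n := by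
  have h := homogeneousComponent_finsetSum_prod (Finset.range n)
    (fun j => (X i - C (j : ℂ) : MvPolynomial (Fin k) ℂ)) (fun _ => 1)
    fun j _ => totalDegree_X_sub_C_le i (j : ℂ)
  simpa [-map_natCast, homogeneousComponent_one_X_sub_C] using h

theorem totalDegree_fallingPoly_le {k : ℕ} (α : Fin k → ℕ) :
    (fallingPoly α).totalDegree ≤ ∑ i, α i :=
  (totalDegree_finsetProd _ _).trans
    (Finset.sum_le_sum fun i _ => totalDegree_prod_X_sub_C_le i (α i))

theorem homogeneousComponent_fallingPoly {k : ℕ} (α : Fin k → ℕ) :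
    homogeneousComponent (∑ i, α i) (fallingPoly α) = ∏ i, X i ^ α i := by
  rw [fallingPoly, homogeneousComponent_finsetSum_prod _ _ _
    fun i _ => totalDegree_prod_X_sub_C_le i (α i)]
  exact Finset.prod_congr rfl fun i _ => homogeneousComponent_prod_X_sub_C i (α i)

/-- The polynomial `∑_{|α| = m} (m!/α!) w^α P_α`. -/
noncomputable def fallingPower {k : ℕ} (m : ℕ) (w : Fin k → ℂ) : MvPolynomial (Fin k) ℂ :=
  ∑ α ∈ (Fintype.piFinset fun _ : Fin k => Finset.range (m + 1)).filter
      (fun α => ∑ i, α i = m),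
    C (((Nat.factorial m : ℂ) / ∏ i, (Nat.factorial (α i) : ℂ)) * ∏ i, w i ^ α i) *
      fallingPoly α

theorem Qform_eq_sum_eval_fallingPower {k : ℕ} (S : Finset (Fin k → ℤ)) (m : ℕ)
    (c : (Fin k → ℤ) → ℂ) (w : Fin k → ℂ) :
    Qform S m c w = ∑ p ∈ S, c p * eval (fun i => (p i : ℂ)) (fallingPower m w) := by
  simp only [Qform, fallingPower, map_sum, eval_mul, eval_C, eval_fallingPoly]

theorem totalDegree_fallingPower_le {k : ℕ} (m : ℕ) (w : Fin k → ℂ) :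
    (fallingPower m w).totalDegree ≤ m := by
  refine totalDegree_finsetSum_le fun α hα => (totalDegree_mul _ _).trans ?_
  rw [totalDegree_C, zero_add]
  exact (totalDegree_fallingPoly_le α).trans (Finset.mem_filter.mp hα).2.le

theorem filter_piFinset_range_eq_piAntidiag (k m : ℕ) :
    (Fintype.piFinset fun _ : Fin k => Finset.range (m + 1)).filter (fun α => ∑ i, α i = m) =
      Finset.piAntidiag Finset.univ m := by
  ext α
  simp only [Finset.mem_filter, Fintype.mem_piFinset, Finset.mem_range, Finset.mem_piAntidiag,
    Finset.mem_univ, implies_true, and_true, and_iff_right_iff_imp]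
  rintro rfl i
  exact Nat.lt_succ_of_le (Finset.single_le_sum (fun _ _ => Nat.zero_le _) (Finset.mem_univ i))

theorem homogeneousComponent_fallingPower {k : ℕ} (m : ℕ) (w : Fin k → ℂ) :
    homogeneousComponent m (fallingPower m w) = (∑ i, C (w i) * X i) ^ m := by
  rw [fallingPower, filter_piFinset_range_eq_piAntidiag, map_sum,
    Finset.sum_pow_eq_sum_piAntidiag]
  refine Finset.sum_congr rfl fun α hα => ?_
  obtain rfl : ∑ i, α i = m := (Finset.mem_piAntidiag.mp hα).1
  have hmult : ((Nat.factorial (∑ i, α i) : ℂ) / ∏ i, (Nat.factorial (α i) : ℂ)) =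
      (Nat.multinomial Finset.univ α : ℂ) := by
    rw [div_eq_iff (Finset.prod_ne_zero_iff.mpr fun i _ =>
      Nat.cast_ne_zero.mpr (Nat.factorial_ne_zero _)), mul_comm]
    exact_mod_cast (Nat.multinomial_spec Finset.univ α).symm
  rw [homogeneousComponent_C_mul, homogeneousComponent_fallingPoly, hmult]
  simp only [C_mul, mul_pow, Finset.prod_mul_distrib, map_prod, C_pow, map_natCast, mul_assoc]

/-- Evaluation of polynomials at the points of `S`, as a linear map. -/
noncomputable def evalOn {k : ℕ} (S : Finset (Fin k → ℤ)) :
    MvPolynomial (Fin k) ℂ →ₗ[ℂ] (S → ℂ) :=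
  LinearMap.pi fun p => (aeval fun i => (p.1 i : ℂ)).toLinearMap

theorem evalOn_apply {k : ℕ} (S : Finset (Fin k → ℤ)) (q : MvPolynomial (Fin k) ℂ) (p : S) :
    evalOn S q p = eval (fun i => (p.1 i : ℂ)) q := by
  simp [evalOn, aeval_eq_eval]

/-- A polynomial annihilated by `K_d(S)` agrees on `S` with a polynomial of degree at most `d`. -/
theorem exists_totalDegree_le_eval_eq {k : ℕ} (S : Finset (Fin k → ℤ)) (d : ℕ)
    (f : MvPolynomial (Fin k) ℂ)
    (h : ∀ c, inKernel S d c → ∑ p ∈ S, c p * eval (fun i => (p i : ℂ)) f = 0) :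
    ∃ q : MvPolynomial (Fin k) ℂ, q.totalDegree ≤ d ∧
      ∀ p ∈ S, eval (fun i => (p i : ℂ)) q = eval (fun i => (p i : ℂ)) f := by
  classical
  have hmem : evalOn S f ∈ (restrictTotalDegree (Fin k) ℂ d).map (evalOn S) := by
    by_contra hf
    obtain ⟨φ, hφ, hle⟩ := Submodule.exists_le_ker_of_notMem hf
    let c : (Fin k → ℤ) → ℂ := fun p => if hp : p ∈ S then φ (Pi.single ⟨p, hp⟩ 1) else 0
    have hc : ∀ q, ∑ p ∈ S, c p * eval (fun i => (p i : ℂ)) q = φ (evalOn S q) := fun q => by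
      rw [LinearMap.pi_apply_eq_sum_univ φ, ← Finset.sum_coe_sort S]
      refine Finset.sum_congr rfl fun p _ => ?_
      have hsingle : (fun j => if p = j then (1 : ℂ) else 0) = Pi.single p 1 := by
        ext j
        simp [Pi.single_apply, eq_comm]
      simp [c, evalOn_apply, mul_comm, hsingle]
    refine hφ ((hc f).symm.trans (h c fun q hq => ?_))
    rw [hc]
    exact hle (Submodule.mem_map_of_mem ((mem_restrictTotalDegree _ _ _).mpr hq))
  obtain ⟨q, hq, hqf⟩ := hmem
  refine ⟨q, (mem_restrictTotalDegree _ _ _).mp hq, fun p hp => ?_⟩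
  simpa only [evalOn_apply] using congrFun hqf ⟨p, hp⟩

/-- **Theorem (base points of the m-th fundamental form).**
`[v]` is a base point of the `m`-th fundamental form of the toric variety `X(S)` at `𝟏`
(i.e. `Q_{c,m}(v) = 0` for all `c ∈ K_{m-1}(S)`) if and only if the points of `S` lie on
an affine hypersurface of degree `m` with leading form `(v·x)^m`. -/
theorem baseLocus_fundamental_form (k : ℕ) (hk : 1 ≤ k) (S : Finset (Fin k → ℤ))
    (m : ℕ) (hm : 2 ≤ m) (v : Fin k → ℂ) (hv : v ≠ 0) :
    (∀ c : (Fin k → ℤ) → ℂ, inKernel S (m - 1) c → Qform S m c v = 0) ↔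
    (∃ F : MvPolynomial (Fin k) ℂ, F.totalDegree ≤ m ∧
      (∀ p ∈ S, MvPolynomial.eval (fun i => (p i : ℂ)) F = 0) ∧
      MvPolynomial.homogeneousComponent m F =
        (∑ i, MvPolynomial.C (v i) * MvPolynomial.X i) ^ m) := by
  constructor
  · intro h
    obtain ⟨q, hq, hqS⟩ := exists_totalDegree_le_eval_eq S (m - 1) (fallingPower m v)
      fun c hc => (Qform_eq_sum_eval_fallingPower S m c v).symm.trans (h c hc)
    refine ⟨fallingPower m v - q, (totalDegree_sub _ _).trans
      (max_le (totalDegree_fallingPower_le m v) (by omega)), fun p hp => ?_, ?_⟩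
    · rw [map_sub, hqS p hp, sub_self]
    · rw [map_sub, homogeneousComponent_fallingPower,
        homogeneousComponent_eq_zero m q (by omega), sub_zero]
  · rintro ⟨F, hF, hFS, hFm⟩ c hc
    have hdeg : (fallingPower m v - F).totalDegree ≤ m - 1 :=
      totalDegree_le_pred_of_homogeneousComponent_eq_zero
        ((totalDegree_sub _ _).trans (max_le (totalDegree_fallingPower_le m v) hF))
        (by rw [map_sub, homogeneousComponent_fallingPower, hFm, sub_self])
    rw [Qform_eq_sum_eval_fallingPower, ← hc _ hdeg]
    refine Finset.sum_congr rfl fun p hp => ?_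
    rw [map_sub, hFS p hp, sub_zero]
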